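/- For every n ≥ 9, every c = (c_0,…,c_{n−1}) ∈ F_2^n with c_1 = 1, and every i ∈ {0,1,2,3}, one has 4·|f̂_i^n(c)| ≤ F̂_3^{n+2}(0), where 0 denotes the zero vector of F_2^{n+2}. -/

import Mathlib

/-- Dot product on `F_2^n`. -/
def dotp (n : ℕ) (c x : Fin n → ZMod 2) : ZMod 2 := ∑ i, c i * x i

/-- Fourier transform of a Boolean function `f : F_2^n → F_2` at `c ∈ F_2^n`. -/
def walsh (n : ℕ) (f : (Fin n → ZMod 2) → ZMod 2) (c : Fin n → ZMod 2) : ℤ :=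
  ∑ x : Fin n → ZMod 2, (-1 : ℤ) ^ (f x + dotp n c x).val

/-- The rotation symmetric function `F_3^n(x) = Σ_i x_i x_{i+1 mod n} x_{i+2 mod n}`. -/
def F3 (n : ℕ) (x : Fin n → ZMod 2) : ZMod 2 :=
  ∑ i : Fin n, x i * x ⟨(i.val + 1) % n, Nat.mod_lt _ i.pos⟩
    * x ⟨(i.val + 2) % n, Nat.mod_lt _ i.pos⟩

/-- `t_m(x) = Σ_{i=0}^{m-3} x_i x_{i+1} x_{i+2}`. -/
def tm (m : ℕ) (x : Fin m → ZMod 2) : ZMod 2 :=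
  ∑ i ∈ Finset.range m,
    if h : i + 2 < m then x ⟨i, by omega⟩ * x ⟨i + 1, by omega⟩ * x ⟨i + 2, by omega⟩ else 0

/-- `f_0^m = t_m`. -/
def f0 (m : ℕ) (x : Fin m → ZMod 2) : ZMod 2 := tm m x

/-- `f_1^m = t_m + x_0 x_1`. -/
def f1 (m : ℕ) (x : Fin m → ZMod 2) : ZMod 2 :=
  if h : 2 ≤ m then tm m x + x ⟨0, by omega⟩ * x ⟨1, by omega⟩ else 0

/-- `f_2^m = t_m + x_{m-2} x_{m-1}`. -/
def f2 (m : ℕ) (x : Fin m → ZMod 2) : ZMod 2 :=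
  if h : 2 ≤ m then tm m x + x ⟨m - 2, by omega⟩ * x ⟨m - 1, by omega⟩ else 0

/-- `f_3^m = t_m + x_0 x_1 + x_{m-2} x_{m-1} + x_0 + x_{m-1}`. -/
def f3 (m : ℕ) (x : Fin m → ZMod 2) : ZMod 2 :=
  if h : 2 ≤ m then
    tm m x + x ⟨0, by omega⟩ * x ⟨1, by omega⟩ + x ⟨m - 2, by omega⟩ * x ⟨m - 1, by omega⟩
      + x ⟨0, by omega⟩ + x ⟨m - 1, by omega⟩
  else 0

/-- `c^m`: the vector of the first `m` coordinates of `c ∈ F_2^n`. -/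
def trunc {n : ℕ} (m : ℕ) (h : m ≤ n) (c : Fin n → ZMod 2) : Fin m → ZMod 2 :=
  fun i => c (Fin.castLE h i)

/-- `e_1 = (1,0,…,0) ∈ F_2^m`. -/
def eOne (m : ℕ) : Fin m → ZMod 2 := fun i => if i.val = 0 then 1 else 0

/-- `e_{2^{m-1}} = (0,…,0,1) ∈ F_2^m`. -/
def eLast (m : ℕ) : Fin m → ZMod 2 := fun i => if i.val = m - 1 then 1 else 0

/-- The weight of a Boolean function: the number of `x` with `f x = 1`. -/
def wt (n : ℕ) (f : (Fin n → ZMod 2) → ZMod 2) : ℕ :=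
  (Finset.univ.filter fun x => f x = 1).card

/-- The additive character of `F_2`. -/
def sgn (a : ZMod 2) : ℤ := if a = 0 then 1 else -1

theorem neg_one_pow_val (a : ZMod 2) : (-1 : ℤ) ^ a.val = sgn a := by
  revert a; decide

theorem sgn_add (a b : ZMod 2) : sgn (a + b) = sgn a * sgn b := by
  revert a b; decide

theorem sum_zmod_two {M : Type*} [AddCommMonoid M] (f : ZMod 2 → M) : ∑ a, f a = f 0 + f 1 :=
  Fin.sum_univ_two f

/-- One step of the transfer recursion of `t_m`, prepending a variable with linear coefficient
`k`. -/
def transfer (k : ZMod 2) (u : ZMod 2 → ZMod 2 → ℤ) (a b : ZMod 2) : ℤ :=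
  ∑ d, sgn (a * b * d + k * a) * u b d

/-- The partial Fourier sums of `t_m`, with weight `Q` on the last two variables, as functions of
the first two variables. -/
def partialSum (Q : ZMod 2 → ZMod 2 → ℤ) :
    (m : ℕ) → (Fin (m + 2) → ZMod 2) → ZMod 2 → ZMod 2 → ℤ
  | 0, c => fun a b => Q a b * sgn (c 0 * a + c 1 * b)
  | m + 1, c => transfer (c 0) (partialSum Q m (Fin.tail c))

theorem tm_cons (m : ℕ) (a : ZMod 2) (x : Fin (m + 2) → ZMod 2) :
    tm (m + 3) (Fin.cons a x : Fin (m + 3) → ZMod 2) = a * x 0 * x 1 + tm (m + 2) x := by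
  unfold tm
  rw [Finset.sum_range_succ', add_comm]
  congr 1
  refine Finset.sum_congr rfl fun i _ => ?_
  by_cases h : i + 2 < m + 2
  · rw [dif_pos h, dif_pos (show i + 1 + 2 < m + 3 by omega)]
    rfl
  · rw [dif_neg h, dif_neg (show ¬ i + 1 + 2 < m + 3 by omega)]

theorem dotp_cons (m : ℕ) (c : Fin (m + 1) → ZMod 2) (a : ZMod 2) (x : Fin m → ZMod 2) :
    dotp (m + 1) c (Fin.cons a x : Fin (m + 1) → ZMod 2)
      = c 0 * a + dotp m (Fin.tail c) x := by
  simp [dotp, Fin.sum_univ_succ, Fin.tail]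

theorem sum_fin_succ_fun (m : ℕ) (f : (Fin (m + 1) → ZMod 2) → ℤ) :
    ∑ x, f x = ∑ a : ZMod 2, ∑ x : Fin m → ZMod 2, f (Fin.cons a x : Fin (m + 1) → ZMod 2) := by
  rw [← (Fin.consEquiv fun _ : Fin (m + 1) => ZMod 2).sum_comp, Fintype.sum_prod_type]
  rfl

theorem sum_weight_mul_sgn (Q : ZMod 2 → ZMod 2 → ℤ) (m : ℕ) (W : ZMod 2 → ZMod 2 → ℤ)
    (c : Fin (m + 2) → ZMod 2) :
    ∑ x : Fin (m + 2) → ZMod 2, W (x 0) (x 1) *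
        (Q (x (Fin.last m).castSucc) (x (Fin.last (m + 1))) * sgn (tm (m + 2) x + dotp (m + 2) c x))
      = ∑ a, ∑ b, W a b * partialSum Q m c a b := by
  induction m generalizing W with
  | zero =>
    rw [sum_fin_succ_fun]
    refine Finset.sum_congr rfl fun a _ => ?_
    rw [sum_fin_succ_fun]
    refine Finset.sum_congr rfl fun b _ => ?_
    rw [Fintype.sum_unique]
    simp only [dotp_cons, partialSum]
    have h1 (x : Fin (0 + 2) → ZMod 2) : tm (0 + 2) x = 0 := by simp [tm]
    have h2 (d x : Fin 0 → ZMod 2) : dotp 0 d x = 0 := by simp [dotp]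
    rw [h1, h2, zero_add (c 0 * a + _), add_zero (Fin.tail c 0 * b)]
    rfl
  | succ m ih =>
    rw [sum_fin_succ_fun]
    refine Finset.sum_congr rfl fun a _ => ?_
    have := ih (fun b d => W a b * sgn (a * b * d + c 0 * a)) (Fin.tail c)
    simp only [partialSum, transfer, Finset.mul_sum]
    simp only [mul_assoc] at this ⊢
    rw [← this]
    refine Finset.sum_congr rfl fun x _ => ?_
    rw [tm_cons, dotp_cons]
    have h : a * x 0 * x 1 + tm (m + 2) x + (c 0 * a + dotp (m + 2) (Fin.tail c) x)
        = (a * (x 0 * x 1) + c 0 * a) + (tm (m + 2) x + dotp (m + 2) (Fin.tail c) x) := by ring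
    rw [h, sgn_add (a * (x 0 * x 1) + c 0 * a)]
    change W a (x 0) * (Q (x (Fin.last m).castSucc) (x (Fin.last (m + 1))) * _) = _
    ring

theorem walsh_eq_sum_partialSum (m : ℕ) (f : (Fin (m + 2) → ZMod 2) → ZMod 2)
    (w q : ZMod 2 → ZMod 2 → ZMod 2)
    (hf : ∀ x, f x = tm (m + 2) x + w (x 0) (x 1)
      + q (x (Fin.last m).castSucc) (x (Fin.last (m + 1))))
    (c : Fin (m + 2) → ZMod 2) :
    walsh (m + 2) f c
      = ∑ a, ∑ b, sgn (w a b) * partialSum (fun a b => sgn (q a b)) m c a b := by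
  rw [← sum_weight_mul_sgn, walsh]
  refine Finset.sum_congr rfl fun x _ => ?_
  rw [neg_one_pow_val, hf, ← sgn_add, ← sgn_add]
  congr 1
  ring

theorem F3_eq (N : ℕ) (x : Fin (N + 2) → ZMod 2) :
    F3 (N + 2) x = tm (N + 2) x
      + x (Fin.last N).castSucc * x (Fin.last (N + 1)) * x 0
      + x (Fin.last (N + 1)) * x 0 * x 1 := by
  rw [F3, tm, Finset.sum_range, Fin.sum_univ_castSucc, Fin.sum_univ_castSucc,
    Fin.sum_univ_castSucc, Fin.sum_univ_castSucc]
  rw [dif_neg (by simp), dif_neg (by simp), add_zero, add_zero]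
  refine congrArg₂ _ (congrArg₂ _ (Finset.sum_congr rfl fun i _ => ?_) ?_) ?_
  · rw [dif_pos (by simp)]
    congr 2
    · congr 1
      congr 1
      exact Nat.mod_eq_of_lt (by simp)
    · congr 1
      exact Nat.mod_eq_of_lt (by simp)
  · congr 2
    · congr 1
      ext
      exact Nat.mod_eq_of_lt (by simp)
    · ext
      simp
  · congr 2
    · congr 1
      ext
      simp
    · ext
      simp [Nat.add_mod_left, show N + 1 + 2 = N + 2 + 1 by omega]

/-- The number `F̂_3^{m+2}(0)`, as a trace. -/
def cyclicSum (m : ℕ) : ℤ :=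
  ∑ a, ∑ b, partialSum (fun p q => sgn (p * q * a + q * a * b)) m 0 a b

theorem walsh_F3_eq_cyclicSum (N : ℕ) : walsh (N + 2) (F3 (N + 2)) 0 = cyclicSum N := by
  have h (a b : ZMod 2) := sum_weight_mul_sgn (fun p q => sgn (p * q * a + q * a * b)) N
    (fun a' b' => if a' = a ∧ b' = b then 1 else 0) 0
  have h' (a b : ZMod 2) (g : ZMod 2 → ZMod 2 → ℤ) :
      ∑ a', ∑ b', (if a' = a ∧ b' = b then 1 else 0) * g a' b' = g a b := by
    simp [ite_and]
  simp only [h'] at h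
  simp only [cyclicSum, ← h]
  rw [Finset.sum_congr rfl fun a _ => Finset.sum_comm, Finset.sum_comm, walsh]
  refine Finset.sum_congr rfl fun x _ => ?_
  rw [neg_one_pow_val, F3_eq]
  simp only [ite_and, ite_mul, one_mul, zero_mul]
  simp only [Finset.sum_ite_irrel, Finset.sum_const_zero, Finset.sum_ite_eq, Finset.mem_univ,
    if_true]
  rw [← sgn_add]
  congr 1
  ring

theorem transfer_apply (k : ZMod 2) (u : ZMod 2 → ZMod 2 → ℤ) :
    transfer k u 0 0 = u 0 0 + u 0 1 ∧ transfer k u 0 1 = u 1 0 + u 1 1 ∧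
    transfer k u 1 0 = sgn k * (u 0 0 + u 0 1) ∧ transfer k u 1 1 = sgn k * (u 1 0 - u 1 1) := by
  have h0 : sgn 0 = 1 := rfl
  have h1 : sgn 1 = -1 := rfl
  simp only [transfer, sum_zmod_two, sgn_add, mul_zero, mul_one, h0, h1]
  refine ⟨?_, ?_, ?_, ?_⟩ <;> ring

theorem partialSum_zero_add_four (Q : ZMod 2 → ZMod 2 → ℤ) (m : ℕ) (a b : ZMod 2) :
    partialSum Q (m + 4) 0 a b
      = 2 * partialSum Q (m + 2) 0 a b + 2 * partialSum Q (m + 1) 0 a b := by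
  have h0 (j : ℕ) : Fin.tail (0 : Fin (j + 1) → ZMod 2) = 0 := rfl
  simp only [partialSum, h0, Pi.zero_apply]
  revert a b
  have h1 : sgn 0 = 1 := rfl
  have key (P : ZMod 2 → Prop) (p0 : P 0) (p1 : P 1) (a : ZMod 2) : P a := by
    fin_cases a
    exacts [p0, p1]
  refine key _ (key _ ?_ ?_) (key _ ?_ ?_) <;> simp only [transfer_apply, h1] <;> ring

theorem cyclicSum_add_four (m : ℕ) :
    cyclicSum (m + 4) = 2 * cyclicSum (m + 2) + 2 * cyclicSum (m + 1) := by
  simp only [cyclicSum, partialSum_zero_add_four, Finset.sum_add_distrib, Finset.mul_sum]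

/-- The eight sums of the values of `u` with affine or bent signs are at most `M` in absolute
value. -/
def SignedSumsLE (u : ZMod 2 → ZMod 2 → ℤ) (M : ℤ) : Prop :=
  (|u 0 0 + u 0 1 + u 1 0 + u 1 1| ≤ M ∧ |u 0 0 + u 0 1 - u 1 0 - u 1 1| ≤ M) ∧
  (|u 0 0 - u 0 1 + u 1 0 - u 1 1| ≤ M ∧ |u 0 0 - u 0 1 - u 1 0 + u 1 1| ≤ M) ∧
  (|u 0 0 + u 0 1 + u 1 0 - u 1 1| ≤ M ∧ |u 0 0 + u 0 1 - u 1 0 + u 1 1| ≤ M) ∧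
  (|u 0 0 - u 0 1 + u 1 0 + u 1 1| ≤ M ∧ |u 0 0 - u 0 1 - u 1 0 - u 1 1| ≤ M)

instance (u : ZMod 2 → ZMod 2 → ℤ) (M : ℤ) : Decidable (SignedSumsLE u M) := by
  unfold SignedSumsLE; infer_instance

theorem sgn_eq (k : ZMod 2) : sgn k = 1 ∨ sgn k = -1 := by
  revert k; decide

theorem signedSumsLE_transfer (k l r : ZMod 2) (u : ZMod 2 → ZMod 2 → ℤ) (M M' : ℤ)
    (h : SignedSumsLE u M) (h' : SignedSumsLE (transfer r u) M') :
    SignedSumsLE (transfer k (transfer l (transfer r u))) (2 * M' + 2 * M) := by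
  simp only [SignedSumsLE, transfer_apply, abs_le] at *
  generalize u 0 0 = p at *
  generalize u 0 1 = q at *
  generalize u 1 0 = s at *
  generalize u 1 1 = t at *
  rcases sgn_eq k with hk | hk <;> rcases sgn_eq l with hl | hl <;> rcases sgn_eq r with hr | hr <;>
    simp only [hk, hl, hr] at * <;> omega

/-- A bound for the Fourier coefficients of `f_0, …, f_3` in `m + 2` variables. -/
def growth : ℕ → ℤ
  | 0 => 4
  | 1 => 6
  | 2 => 12
  | m + 3 => 2 * growth (m + 1) + 2 * growth m

theorem signedSumsLE_partialSum {q : ZMod 2 → ZMod 2 → ZMod 2}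
    (hq : q = (fun _ _ => 0) ∨ q = (fun a b => a * b) ∨ q = (fun a b => a * b + b)) :
    ∀ (m : ℕ) (c : Fin (m + 2) → ZMod 2),
      SignedSumsLE (partialSum (fun a b => sgn (q a b)) m c) (growth m)
  | 0, c => by
    have h : ∀ k l : ZMod 2,
        SignedSumsLE (fun a b => sgn (q a b) * sgn (k * a + l * b)) 4 := by
      rcases hq with rfl | rfl | rfl <;> decide
    exact h _ _
  | 1, c => by
    have h : ∀ j k l : ZMod 2, SignedSumsLE
        (transfer j fun a b => sgn (q a b) * sgn (k * a + l * b)) 6 := by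
      rcases hq with rfl | rfl | rfl <;> decide
    exact h _ _ _
  | 2, c => by
    have h : ∀ i j k l : ZMod 2, SignedSumsLE
        (transfer i (transfer j fun a b => sgn (q a b) * sgn (k * a + l * b))) 12 := by
      rcases hq with rfl | rfl | rfl <;> decide
    exact h _ _ _ _
  | m + 3, c => signedSumsLE_transfer _ _ _ _ _ _
      (signedSumsLE_partialSum hq m _) (signedSumsLE_partialSum hq (m + 1) _)

set_option maxHeartbeats 4000000 in
theorem abs_signed_sum_transfer_le (k r s t v : ZMod 2) (u : ZMod 2 → ZMod 2 → ℤ) (M M' : ℤ)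
    (h : SignedSumsLE u M) (h' : SignedSumsLE (transfer v u) M') (w : ZMod 2 → ZMod 2 → ZMod 2)
    (hw : w = (fun _ _ => 0) ∨ w = (fun a b => a * b) ∨ w = (fun a b => a * b + a)) :
    |∑ a, ∑ b, sgn (w a b) *
      transfer k (transfer 1 (transfer r (transfer s (transfer t (transfer v u))))) a b|
      ≤ 8 * M' + 4 * M := by
  have h0 : sgn 0 = 1 := rfl
  have h1 : sgn 1 = -1 := rfl
  have h2 : sgn (1 + 1) = 1 := rfl
  simp only [SignedSumsLE, sum_zmod_two, transfer_apply, h1, abs_le] at h h' ⊢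
  generalize u 0 0 = p at *
  generalize u 0 1 = q at *
  generalize u 1 0 = x at *
  generalize u 1 1 = y at *
  rcases hw with rfl | rfl | rfl <;>
  simp only [mul_one, mul_zero, add_zero, zero_add, h0, h1, h2] <;>
  rcases sgn_eq k with hk | hk <;> rcases sgn_eq r with hr | hr <;>
  rcases sgn_eq s with hs | hs <;> rcases sgn_eq t with ht | ht <;>
  rcases sgn_eq v with hv | hv <;>
    simp only [hk, hr, hs, ht, hv] at * <;> omega

theorem growth_le_cyclicSum : ∀ m : ℕ,
    4 * (8 * growth (m + 2) + 4 * growth (m + 1)) ≤ cyclicSum (m + 9)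
  | 0 => by decide
  | 1 => by decide
  | 2 => by decide
  | m + 3 => by
    have h1 := growth_le_cyclicSum (m + 1)
    have h0 := growth_le_cyclicSum m
    have h := cyclicSum_add_four (m + 8)
    have g4 : growth (m + 4) = 2 * growth (m + 2) + 2 * growth (m + 1) := rfl
    have g5 : growth (m + 5) = 2 * growth (m + 3) + 2 * growth (m + 2) := rfl
    simp only [add_assoc, Nat.reduceAdd] at *
    linarith

theorem four_mul_abs_walsh_le (m : ℕ) (f : (Fin (m + 9) → ZMod 2) → ZMod 2)
    (w q : ZMod 2 → ZMod 2 → ZMod 2)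
    (hf : ∀ x : Fin (m + 9) → ZMod 2, f x = tm (m + 9) x + w (x 0) (x 1)
      + q (x (Fin.last (m + 7)).castSucc) (x (Fin.last (m + 8))))
    (hw : w = (fun _ _ => 0) ∨ w = (fun a b => a * b) ∨ w = (fun a b => a * b + a))
    (hq : q = (fun _ _ => 0) ∨ q = (fun a b => a * b) ∨ q = (fun a b => a * b + b))
    (c : Fin (m + 9) → ZMod 2) (hc : c 1 = 1) :
    4 * |walsh (m + 9) f c| ≤ walsh (m + 11) (F3 (m + 11)) 0 := by
  rw [walsh_F3_eq_cyclicSum (m + 9), walsh_eq_sum_partialSum (m + 7) f w q hf]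
  refine le_trans ?_ (growth_le_cyclicSum m)
  simp only [partialSum]
  have hc' : Fin.tail c 0 = 1 := hc
  rw [hc']
  exact mul_le_mul_of_nonneg_left (abs_signed_sum_transfer_le _ _ _ _ _ _ _ _
    (signedSumsLE_partialSum hq (m + 1) _) (signedSumsLE_partialSum hq (m + 2) _) w hw)
    (by norm_num)

/-- For every `n ≥ 9` and `c ∈ F_2^n` with `c_1 = 1`, for each
`i ∈ {0,1,2,3}` one has `4·|f̂_i^n(c)| ≤ F̂_3^{n+2}(0)`. -/
theorem stmt_17 (n : ℕ) (hn : 9 ≤ n) (c : Fin n → ZMod 2)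
    (hc : c ⟨1, by omega⟩ = 1) :
    4 * |walsh n (f0 n) c| ≤ walsh (n + 2) (F3 (n + 2)) 0
    ∧ 4 * |walsh n (f1 n) c| ≤ walsh (n + 2) (F3 (n + 2)) 0
    ∧ 4 * |walsh n (f2 n) c| ≤ walsh (n + 2) (F3 (n + 2)) 0
    ∧ 4 * |walsh n (f3 n) c| ≤ walsh (n + 2) (F3 (n + 2)) 0 := by
  obtain ⟨m, rfl⟩ := Nat.exists_eq_add_of_le' hn
  refine ⟨?_, ?_, ?_, ?_⟩
  · refine four_mul_abs_walsh_le m _ (fun _ _ => 0) (fun _ _ => 0) (fun x => ?_)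
      (by simp) (by simp) c hc
    simp [f0]
  · refine four_mul_abs_walsh_le m _ (fun a b => a * b) (fun _ _ => 0) (fun x => ?_)
      (by simp) (by simp) c hc
    rw [f1, dif_pos (by omega), add_zero]
    rfl
  · refine four_mul_abs_walsh_le m _ (fun _ _ => 0) (fun a b => a * b) (fun x => ?_)
      (by simp) (by simp) c hc
    rw [f2, dif_pos (by omega), add_zero]
    rfl
  · refine four_mul_abs_walsh_le m _ (fun a b => a * b + a) (fun a b => a * b + b) (fun x => ?_)
      (by simp) (by simp) c hc
    rw [f3, dif_pos (by omega)]
    change tm (m + 9) x + x 0 * x 1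
      + x (Fin.last (m + 7)).castSucc * x (Fin.last (m + 8)) + x 0 + x (Fin.last (m + 8)) = _
    ring
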